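/- If c = a and d = b (the parallelogram case), then g(x) = x for every x ∈ (−1, 1). -/

import Mathlib

open Real Set

/-- The cosine rule in the triangle with sides `a`, `b` and exterior angle cosine `x`: the angle
adjacent to `a` and the third side `e` has cosine `(a + b * x) / e` and sine `b * √(1 - x²) / e`. -/
theorem cos_and_sin_arccos_of_sq_eq {a b x e : ℝ} (ha : 0 < a) (hb : 0 < b) (he : 0 < e)
    (hx : x ^ 2 ≤ 1) (he2 : e ^ 2 = a ^ 2 + b ^ 2 + 2 * a * b * x) :
    Real.cos (Real.arccos ((a ^ 2 + e ^ 2 - b ^ 2) / (2 * a * e))) = (a + b * x) / e ∧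
    Real.sin (Real.arccos ((a ^ 2 + e ^ 2 - b ^ 2) / (2 * a * e))) =
      b * Real.sqrt (1 - x ^ 2) / e := by
  have hu : (a ^ 2 + e ^ 2 - b ^ 2) / (2 * a * e) = (a + b * x) / e := by
    rw [div_eq_div_iff (by positivity) he.ne', he2]
    ring
  have hs : Real.sqrt (1 - x ^ 2) ^ 2 = 1 - x ^ 2 := Real.sq_sqrt (by linarith)
  have hsq : 1 - ((a + b * x) / e) ^ 2 = (b * Real.sqrt (1 - x ^ 2) / e) ^ 2 := by
    rw [div_pow, div_pow, mul_pow, hs]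
    field_simp
    rw [he2]
    ring
  have habs : |(a + b * x) / e| ≤ 1 := by
    rw [← sq_le_one_iff_abs_le_one]
    linarith [sq_nonneg (b * Real.sqrt (1 - x ^ 2) / e)]
  rw [hu, Real.sin_arccos, hsq, Real.sqrt_sq (by positivity)]
  exact ⟨Real.cos_arccos (abs_le.mp habs).1 (abs_le.mp habs).2, rfl⟩

/-- Fix positive reals `a, b, c, d` with `c = a` and `d = b` (the parallelogram case).
For `x ∈ (−1, 1)` set `E(x) = √(a² + d² + 2adx)` and
`g(x) = cos(arccos((a² + E² − d²)/(2aE)) + arccos((b² + E² − c²)/(2bE)))`.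
Then `g(x) = x` for every `x ∈ (−1, 1)`. -/
theorem g_id_of_parallelogram (a b c d : ℝ) (ha : 0 < a) (hb : 0 < b) (hc : 0 < c) (hd : 0 < d)
    (hca : c = a) (hdb : d = b)
    (E g : ℝ → ℝ)
    (hE : ∀ x, E x = Real.sqrt (a ^ 2 + d ^ 2 + 2 * a * d * x))
    (hg : ∀ x, g x = Real.cos (Real.arccos ((a ^ 2 + (E x) ^ 2 - d ^ 2) / (2 * a * E x))
      + Real.arccos ((b ^ 2 + (E x) ^ 2 - c ^ 2) / (2 * b * E x)))) :
    ∀ x ∈ Ioo (-1 : ℝ) 1, g x = x := by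
  subst hca hdb
  rintro x ⟨hx₁, hx₂⟩
  have hpos : 0 < c ^ 2 + d ^ 2 + 2 * c * d * x := by
    nlinarith [sq_nonneg (c - d), mul_pos (mul_pos hc hd) (neg_lt_iff_pos_add.mp hx₁)]
  have hx : x ^ 2 ≤ 1 := by nlinarith
  have he : 0 < E x := hE x ▸ Real.sqrt_pos.mpr hpos
  have he2 : E x ^ 2 = c ^ 2 + d ^ 2 + 2 * c * d * x := by rw [hE, Real.sq_sqrt hpos.le]
  obtain ⟨hcos₁, hsin₁⟩ := cos_and_sin_arccos_of_sq_eq hc hd he hx he2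
  obtain ⟨hcos₂, hsin₂⟩ := cos_and_sin_arccos_of_sq_eq hd hc he hx (by rw [he2]; ring)
  have hs : Real.sqrt (1 - x ^ 2) ^ 2 = 1 - x ^ 2 := Real.sq_sqrt (by linarith)
  rw [hg, Real.cos_add, hcos₁, hcos₂, hsin₁, hsin₂]
  field_simp
  rw [hs, he2]
  ring
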